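/- Convergence to a stationary point along the limit flow: J(f_{θ̄_t}) converges to a finite value as t → ∞, and lim_{t→∞} ∇_θ J(f_{θ̄_t}) = 0. -/

import Mathlib

open MeasureTheory Filter Set
open scoped Classical

noncomputable section

def softmaxPol {X A : Type*} [Fintype A] (θ : X → A → ℝ) (x : X) (a : A) : ℝ :=
  Real.exp (θ x a) / ∑ a', Real.exp (θ x a')

def explorePol {X A : Type*} [Fintype A] (η : ℝ) (θ : X → A → ℝ) (x : X) (a : A) : ℝ :=
  η / (Fintype.card A : ℝ) + (1 - η) * softmaxPol θ x a

def zetaN (N k : ℕ) : ℝ := (1 + (k : ℝ) / (N : ℝ))⁻¹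

def etaN (N k : ℕ) : ℝ := (1 + (Real.log ((k : ℝ) / (N : ℝ) + 1)) ^ 2)⁻¹

def zetaT (t : ℝ) : ℝ := (1 + t)⁻¹

def etaT (t : ℝ) : ℝ := (1 + (Real.log (t + 1)) ^ 2)⁻¹

def IsPolicy {X A : Type*} [Fintype A] (f : X → A → ℝ) : Prop :=
  (∀ x a, 0 ≤ f x a) ∧ ∀ x, ∑ a, f x a = 1

def ptilde {X A : Type*} (γ : ℝ) (p : X → A → X → ℝ) (μ : X → ℝ)
    (x : X) (a : A) (x' : X) : ℝ :=
  γ * p x a x' + (1 - γ) * μ x'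

def actorKer {X A : Type*} (γ : ℝ) (p : X → A → X → ℝ) (μ : X → ℝ) (f : X → A → ℝ) :
    X × A → X × A → ℝ :=
  fun ξ ξ' => ptilde γ p μ ξ.1 ξ.2 ξ'.1 * f ξ'.1 ξ'.2

def criticKer {X A : Type*} (p : X → A → X → ℝ) (g : X → A → ℝ) :
    X × A → X × A → ℝ :=
  fun ξ ξ' => p ξ.1 ξ.2 ξ'.1 * g ξ'.1 ξ'.2

def kpow {S : Type*} [Fintype S] [DecidableEq S] (K : S → S → ℝ) : ℕ → S → S → ℝ
  | 0 => fun ξ ξ' => if ξ = ξ' then 1 else 0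
  | n + 1 => fun ξ ξ' => ∑ y, K ξ y * kpow K n y ξ'

def IsStationaryDist {S : Type*} [Fintype S] (K : S → S → ℝ) (d : S → ℝ) : Prop :=
  (∀ ξ, 0 ≤ d ξ) ∧ (∑ ξ, d ξ = 1) ∧ ∀ ξ', d ξ' = ∑ ξ, d ξ * K ξ ξ'

def pathSum {X A : Type*} [Fintype X] [Fintype A] [DecidableEq X]
    (p : X → A → X → ℝ) : ℕ → X → A → X → ℝ
  | 0 => fun x _ x' => if x = x' then 1 else 0
  | 1 => fun x a x' => p x a x'
  | n + 2 => fun x a x' => ∑ x₁ : X, ∑ a₁ : A, p x a x₁ * pathSum p (n + 1) x₁ a₁ x'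

section Analysis

theorem norm_sub_lt_of_barrier {ι : Type*} [Fintype ι] {Q R Q' : ℝ → ι → ℝ}
    {B B' Z Z' : ℝ → ℝ} {a K : ℝ}
    (hQc : ContinuousOn Q (Ici a)) (hRc : ContinuousOn R (Ici a)) (hBc : ContinuousOn B (Ici a))
    (hQ : ∀ t, a < t → ∀ i, HasDerivAt (fun s => Q s i) (Q' t i) t)
    (hB : ∀ t, a < t → HasDerivAt B (B' t) t)
    (hZ : ∀ t, a < t → HasDerivAt Z (Z' t) t)
    (hBpos : ∀ t, a ≤ t → 0 < B t)
    (hR : ∀ s t, a ≤ s → s ≤ t → ∀ i, |R t i - R s i| ≤ K * (Z t - Z s))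
    (hstart : ∀ i, |Q a i - R a i| < B a)
    (hbar : ∀ t, a < t → (∀ j, |Q t j - R t j| ≤ B t) → ∀ i c, |c| = 1 →
      c * (Q t i - R t i) = B t → c * Q' t i < B' t - K * Z' t) :
    ∀ t, a ≤ t → ∀ i, |Q t i - R t i| < B t := by
  have key : ∀ t, a ≤ t → ‖Q t - R t‖ < B t := by
    by_contra! hcon
    obtain ⟨t₁, ht₁, hb₁⟩ := hcon
    set S : Set ℝ := {t | t ∈ Ici a ∧ B t ≤ ‖Q t - R t‖} with hS
    have hcl : IsClosed S := isClosed_Ici.isClosed_le hBc (hQc.sub hRc).norm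
    have hbd : BddBelow S := ⟨a, fun t ht => ht.1⟩
    have hmem : sInf S ∈ S := hcl.csInf_mem ⟨t₁, ht₁, hb₁⟩ hbd
    set t := sInf S with ht
    have hlt : ∀ s, a ≤ s → s < t → ‖Q s - R s‖ < B s := by
      intro s hs hst
      by_contra! h
      exact absurd (csInf_le hbd (show s ∈ S from ⟨hs, h⟩)) (not_le.2 hst)
    have hat : a < t := by
      refine lt_of_le_of_ne hmem.1 fun h => ?_
      have h1 := hmem.2
      rw [← h] at h1
      exact absurd ((pi_norm_lt_iff (hBpos a le_rfl)).2 hstart) (not_lt.2 h1)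
    have hle : ‖Q t - R t‖ ≤ B t := by
      have hc : ContinuousWithinAt (fun s => B s - ‖Q s - R s‖) (Ioo a t) t :=
        ((hBc.sub (hQc.sub hRc).norm) t hat.le).mono (fun s hs => hs.1.le)
      have : (nhdsWithin t (Ioo a t)).NeBot := by
        rw [← mem_closure_iff_nhdsWithin_neBot, closure_Ioo hat.ne]
        exact ⟨hat.le, le_rfl⟩
      have h0 := ge_of_tendsto hc (b := 0) (by
        filter_upwards [self_mem_nhdsWithin] with s hs
        exact sub_nonneg.2 (hlt s hs.1.le hs.2).le)
      linarith
    have heq : ‖Q t - R t‖ = B t := le_antisymm hle hmem.2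
    have hall : ∀ j, |Q t j - R t j| ≤ B t := fun j =>
      (norm_le_pi_norm (Q t - R t) j).trans hle
    obtain ⟨i, hi⟩ : ∃ i, |Q t i - R t i| = B t := by
      by_contra! h
      have := (pi_norm_lt_iff (x := Q t - R t) (hBpos t hat.le)).2
        (fun j => lt_of_le_of_ne (hall j) (h j))
      exact absurd heq this.ne
    obtain ⟨c, hc, hci⟩ : ∃ c : ℝ, |c| = 1 ∧ c * (Q t i - R t i) = B t := by
      rcases le_total 0 (Q t i - R t i) with h | h
      · exact ⟨1, by simp, by rw [← hi, abs_of_nonneg h, one_mul]⟩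
      · exact ⟨-1, by simp, by rw [← hi, abs_of_nonpos h]; ring⟩
    have hd : HasDerivAt (fun s => B s + K * (Z t - Z s) - c * (Q s i - R t i))
        (B' t + K * (0 - Z' t) - c * (Q' t i - 0)) t :=
      ((hB t hat).add (((hasDerivAt_const t (Z t)).sub (hZ t hat)).const_mul K)).sub
        (((hQ t hat i).sub (hasDerivAt_const t (R t i))).const_mul c)
    have hstrict := hbar t hat hall i c hc hci
    have hpos : 0 < B' t + K * (0 - Z' t) - c * (Q' t i - 0) := by linarith
    have hev : ∀ᶠ s in nhdsWithin t (Iio t),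
        0 < slope (fun s => B s + K * (Z t - Z s) - c * (Q s i - R t i)) t s :=
      ((hasDerivAt_iff_tendsto_slope.1 hd).mono_left
        (nhdsWithin_mono _ fun s hs => ne_of_lt hs)).eventually (lt_mem_nhds hpos)
    have hev2 : ∀ᶠ s in nhdsWithin t (Iio t), a < s :=
      nhdsWithin_le_nhds (lt_mem_nhds hat)
    obtain ⟨s, ⟨hs1, hs2⟩, hs3⟩ := ((hev.and hev2).and self_mem_nhdsWithin).exists
    have hst : s < t := hs3
    rw [slope_def_field, hci, sub_self, mul_zero, add_zero, sub_self, sub_zero] at hs1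
    have hn : 0 ≤ B s + K * (Z t - Z s) - c * (Q s i - R t i) := by
      have h1 : |Q s i - R s i| ≤ B s :=
        (norm_le_pi_norm (Q s - R s) i).trans (hlt s hs2.le hst).le
      have h2 := hR s t hs2.le hst.le i
      have h3 : c * (Q s i - R t i) ≤ |Q s i - R s i| + |R t i - R s i| := by
        calc c * (Q s i - R t i) ≤ |c * (Q s i - R t i)| := le_abs_self _
          _ = |(Q s i - R s i) - (R t i - R s i)| := by rw [abs_mul, hc, one_mul]; ring_nf
          _ ≤ _ := abs_sub _ _
      linarith
    exact absurd hs1 (not_lt.2 (div_nonpos_of_nonneg_of_nonpos hn (by linarith)))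
  intro t ht i
  exact (norm_le_pi_norm (Q t - R t) i).trans_lt (key t ht)

theorem hasDerivAt_mul_of_eq_zero {D w : ℝ → ℝ} {w' t : ℝ} (hD : ContinuousAt D t)
    (hw : HasDerivAt w w' t) (h0 : w t = 0) :
    HasDerivAt (fun s => D s * w s) (D t * w') t := by
  rw [hasDerivAt_iff_tendsto_slope] at hw ⊢
  refine ((hD.tendsto.mono_left nhdsWithin_le_nhds).mul hw).congr fun s => ?_
  simp only [slope_def_field, h0, mul_zero, sub_zero]
  ring

theorem hasDerivAt_log_add_one {t : ℝ} (ht : 0 ≤ t) :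
    HasDerivAt (fun s => Real.log (s + 1)) (zetaT t) t := by
  have := ((hasDerivAt_id t).add_const (1 : ℝ)).log (by simp; positivity)
  simpa [zetaT, add_comm] using this

theorem zetaT_pos {t : ℝ} (ht : 0 ≤ t) : 0 < zetaT t := by
  unfold zetaT; positivity

theorem etaT_pos (t : ℝ) : 0 < etaT t := by
  unfold etaT; positivity

theorem etaT_le_one (t : ℝ) : etaT t ≤ 1 :=
  inv_le_one_of_one_le₀ (by nlinarith [sq_nonneg (Real.log (t + 1))])

theorem etaT_lt_one {t : ℝ} (ht : 0 < t) : etaT t < 1 := by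
  have : 0 < Real.log (t + 1) := Real.log_pos (by linarith)
  exact inv_lt_one_of_one_lt₀ (by nlinarith)

theorem log_add_one_mono {s t : ℝ} (hs : 0 ≤ s) (hst : s ≤ t) :
    Real.log (s + 1) ≤ Real.log (t + 1) :=
  Real.log_le_log (by linarith) (by linarith)

theorem abs_sub_le_log {u u' : ℝ → ℝ} {K : ℝ}
    (hu : ∀ t, 0 ≤ t → HasDerivAt u (u' t) t) (hK : ∀ t, 0 < t → |u' t| ≤ K * zetaT t)
    {s t : ℝ} (hs : 0 ≤ s) (hst : s ≤ t) :
    |u t - u s| ≤ K * (Real.log (t + 1) - Real.log (s + 1)) := by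
  have aux : ∀ c : ℝ, |c| = 1 →
      c * (u t - u s) ≤ K * (Real.log (t + 1) - Real.log (s + 1)) := by
    intro c hc
    have hd : ∀ r, 0 ≤ r → HasDerivAt (fun r => K * Real.log (r + 1) - c * u r)
        (K * zetaT r - c * u' r) r := fun r hr =>
      ((hasDerivAt_log_add_one hr).const_mul K).sub ((hu r hr).const_mul c)
    have hm : MonotoneOn (fun r => K * Real.log (r + 1) - c * u r) (Ici 0) := by
      refine monotoneOn_of_hasDerivWithinAt_nonneg (convex_Ici 0)
        (fun r hr => (hd r hr).continuousAt.continuousWithinAt)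
        (f' := fun r => K * zetaT r - c * u' r) (fun r hr => ?_) (fun r hr => ?_)
      · exact (hd r (interior_subset hr)).hasDerivWithinAt
      · rw [interior_Ici] at hr
        have h1 : c * u' r ≤ |u' r| := by
          calc c * u' r ≤ |c * u' r| := le_abs_self _
            _ = |u' r| := by rw [abs_mul, hc, one_mul]
        linarith [hK r hr]
    have := hm (show s ∈ Ici (0 : ℝ) from hs) (show t ∈ Ici (0 : ℝ) from hs.trans hst) hst
    simp only at this
    linarith
  rw [abs_le]
  have h1 := aux 1 (by simp)
  have h2 := aux (-1) (by simp)
  constructor <;> linarith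

theorem hasDerivAt_etaT {t : ℝ} (ht : 0 ≤ t) :
    ∃ η' : ℝ, HasDerivAt etaT η' t ∧ |η'| ≤ zetaT t * etaT t := by
  have hpos : 0 < 1 + (Real.log (t + 1)) ^ 2 := by positivity
  have h := (((hasDerivAt_log_add_one ht).pow 2).const_add 1).inv hpos.ne'
  refine ⟨_, h, ?_⟩
  have hz := zetaT_pos ht
  simp only [etaT, Nat.cast_ofNat, Nat.add_one_sub_one, pow_one, Pi.pow_apply]
  rw [abs_div, abs_neg, abs_of_pos (pow_pos hpos 2), div_le_iff₀ (pow_pos hpos 2),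
    abs_mul, abs_of_pos hz, abs_mul, abs_two]
  have : 2 * |Real.log (t + 1)| ≤ 1 + (Real.log (t + 1)) ^ 2 := by
    nlinarith [sq_nonneg (|Real.log (t + 1)| - 1), sq_abs (Real.log (t + 1))]
  calc 2 * |Real.log (t + 1)| * zetaT t ≤ (1 + (Real.log (t + 1)) ^ 2) * zetaT t := by gcongr
    _ = _ := by field_simp

theorem hasDerivAt_arctan_log {t : ℝ} (ht : 0 ≤ t) :
    HasDerivAt (fun s => Real.arctan (Real.log (s + 1))) (zetaT t * etaT t) t := by
  have := (hasDerivAt_log_add_one ht).arctan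
  simpa [etaT, mul_comm] using this

theorem tendsto_log_add_one : Tendsto (fun t : ℝ => Real.log (t + 1)) atTop atTop :=
  Real.tendsto_log_atTop.comp (tendsto_atTop_add_const_right _ _ tendsto_id)

theorem eventually_zetaT_lt (m : ℕ) {κ K : ℝ} (hκ : 0 < κ) :
    ∀ᶠ t in atTop, K * zetaT t < κ * etaT t ^ m := by
  have h1 : ∀ᶠ y : ℝ in atTop, ‖Real.log y ^ (2 * m)‖ ≤ (κ / (2 ^ m * (|K| + 1))) * ‖y‖ :=
    (Real.isLittleO_pow_log_id_atTop (n := 2 * m)).def (by positivity)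
  have h1' := (tendsto_atTop_add_const_right atTop (1 : ℝ) tendsto_id).eventually h1
  filter_upwards [h1', tendsto_log_add_one.eventually_ge_atTop 1, eventually_ge_atTop 0]
    with t ht hlog ht0
  simp only [id] at ht
  set l := Real.log (t + 1)
  have ht1 : 0 < t + 1 := by linarith
  rw [Real.norm_of_nonneg (by positivity), Real.norm_of_nonneg ht1.le] at ht
  have h2 : (1 + l ^ 2) ^ m ≤ 2 ^ m * l ^ (2 * m) := by
    rw [pow_mul, ← mul_pow]
    exact pow_le_pow_left₀ (by positivity) (by nlinarith) m
  have h3 : 2 ^ m * l ^ (2 * m) * (|K| + 1) ≤ κ * (t + 1) := by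
    calc 2 ^ m * l ^ (2 * m) * (|K| + 1) = (2 ^ m * (|K| + 1)) * l ^ (2 * m) := by ring
      _ ≤ (2 ^ m * (|K| + 1)) * (κ / (2 ^ m * (|K| + 1)) * (t + 1)) := by gcongr
      _ = _ := by field_simp
  have h4 : (1 + l ^ 2) ^ m * K < κ * (t + 1) := by
    calc (1 + l ^ 2) ^ m * K ≤ (1 + l ^ 2) ^ m * |K| := by gcongr; exact le_abs_self K
      _ < (1 + l ^ 2) ^ m * (|K| + 1) := by gcongr; linarith
      _ ≤ 2 ^ m * l ^ (2 * m) * (|K| + 1) := by gcongr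
      _ ≤ _ := h3
  have h5 : etaT t = (1 + l ^ 2)⁻¹ := rfl
  rw [h5, zetaT, inv_pow, ← div_eq_mul_inv, ← div_eq_mul_inv,
    div_lt_div_iff₀ (by linarith) (by positivity)]
  linarith

theorem tendsto_zero_of_log_lipschitz {G H H' : ℝ → ℝ} {T K κ l : ℝ} (hT : 0 ≤ T) (hκ : 0 < κ)
    (hH : ∀ t, T ≤ t → HasDerivAt H (H' t) t)
    (hG : ∀ t, T ≤ t → κ * zetaT t * G t ^ 2 ≤ H' t)
    (hlim : Tendsto H atTop (nhds l))
    (hLip : ∀ s t, T ≤ s → s ≤ t → |G t - G s| ≤ K * (Real.log (t + 1) - Real.log (s + 1))) :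
    Tendsto G atTop (nhds 0) := by
  rw [Metric.tendsto_atTop]
  intro ε hε
  set δ : ℝ := ε / (2 * (|K| + 1)) with hδ
  have hδpos : 0 < δ := by positivity
  set c : ℝ := κ * (ε / 2) ^ 2 with hc
  have hcpos : 0 < c := by positivity
  obtain ⟨N, hN⟩ := Metric.tendsto_atTop.1 hlim (c * δ / 2) (by positivity)
  refine ⟨max N T, fun t ht => ?_⟩
  have htN : N ≤ t := (le_max_left _ _).trans ht
  have htT : T ≤ t := (le_max_right _ _).trans ht
  have ht0 : 0 ≤ t := hT.trans htT
  rw [Real.dist_eq, sub_zero]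
  by_contra! hge
  set s : ℝ := (t + 1) * Real.exp δ - 1 with hs
  have hts : t ≤ s := by
    have : 1 ≤ Real.exp δ := Real.one_le_exp hδpos.le
    nlinarith
  have hlogs : Real.log (s + 1) = Real.log (t + 1) + δ := by
    rw [hs, sub_add_cancel, Real.log_mul (by positivity) (by positivity), Real.log_exp]
  have hd : ∀ r, T ≤ r → HasDerivAt (fun r => H r - c * Real.log (r + 1))
      (H' r - c * zetaT r) r := fun r hr =>
    (hH r hr).sub ((hasDerivAt_log_add_one (hT.trans hr)).const_mul c)
  have hm : MonotoneOn (fun r => H r - c * Real.log (r + 1)) (Icc t s) := by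
    refine monotoneOn_of_hasDerivWithinAt_nonneg (convex_Icc t s)
      (fun r hr => (hd r (htT.trans hr.1)).continuousAt.continuousWithinAt)
      (f' := fun r => H' r - c * zetaT r) (fun r hr => ?_) (fun r hr => ?_)
    · exact (hd r (htT.trans (interior_subset hr).1)).hasDerivWithinAt
    · have hr' := interior_subset hr
      have hrT := htT.trans hr'.1
      have h1 := hLip t r htT hr'.1
      have h2 : Real.log (r + 1) - Real.log (t + 1) ≤ δ := by
        have := log_add_one_mono (hT.trans hrT) hr'.2
        linarith
      have h2' : 0 ≤ Real.log (r + 1) - Real.log (t + 1) :=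
        sub_nonneg.2 (log_add_one_mono ht0 hr'.1)
      have h3 : K * (Real.log (r + 1) - Real.log (t + 1)) ≤ ε / 2 := by
        calc K * (Real.log (r + 1) - Real.log (t + 1)) ≤ (|K| + 1) * δ := by
              gcongr
              linarith [le_abs_self K]
          _ = ε / 2 := by rw [hδ]; field_simp
      have h4 : ε / 2 ≤ |G r| := by
        have := abs_sub_abs_le_abs_sub (G t) (G r)
        rw [abs_sub_comm] at this
        linarith
      have h5 : (ε / 2) ^ 2 ≤ G r ^ 2 := by
        rw [← sq_abs (G r)]; gcongr
      have h6 := hG r hrT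
      have h7 := zetaT_pos (hT.trans hrT)
      have : c * zetaT r ≤ κ * zetaT r * G r ^ 2 := by
        rw [hc, mul_right_comm]; gcongr
      linarith
  have h := hm ⟨le_rfl, hts⟩ ⟨hts, le_rfl⟩ hts
  simp only [hlogs] at h
  have h1 := abs_lt.1 (hN t htN)
  have h2 := abs_lt.1 (hN s (htN.trans hts))
  linarith [h1.1, h2.2]

end Analysis

section DecisionProcess

variable {X A : Type*} [Fintype A]

theorem abs_sum_mul_le_of_sum_eq_one {ι : Type*} [Fintype ι] {w h : ι → ℝ} {M : ℝ}
    (hw : ∀ i, 0 ≤ w i) (hw1 : ∑ i, w i = 1) (hh : ∀ i, |h i| ≤ M) :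
    |∑ i, w i * h i| ≤ M := by
  calc |∑ i, w i * h i| ≤ ∑ i, |w i * h i| := Finset.abs_sum_le_sum_abs _ _
    _ ≤ ∑ i, w i * M := Finset.sum_le_sum fun i _ => by
        rw [abs_mul, abs_of_nonneg (hw i)]
        exact mul_le_mul_of_nonneg_left (hh i) (hw i)
    _ = M := by rw [← Finset.sum_mul, hw1, one_mul]

theorem abs_sum_mul_le_sum_abs_mul {ι : Type*} [Fintype ι] {w h : ι → ℝ} {M D : ℝ} (hM : 0 ≤ M)
    (hh : ∀ i, |h i| ≤ M) (hw : ∑ i, |w i| ≤ D) : |∑ i, w i * h i| ≤ D * M := by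
  calc |∑ i, w i * h i| ≤ ∑ i, |w i * h i| := Finset.abs_sum_le_sum_abs _ _
    _ ≤ ∑ i, |w i| * M := Finset.sum_le_sum fun i _ => by
        rw [abs_mul]; exact mul_le_mul_of_nonneg_left (hh i) (abs_nonneg _)
    _ ≤ D * M := by rw [← Finset.sum_mul]; gcongr

theorem isPolicy_softmaxPol [Nonempty A] (θ : X → A → ℝ) : IsPolicy (softmaxPol θ) := by
  have hpos : ∀ x, 0 < ∑ a', Real.exp (θ x a') := fun x =>
    Finset.sum_pos (fun a _ => Real.exp_pos _) Finset.univ_nonempty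
  refine ⟨fun x a => div_nonneg (Real.exp_pos _).le (hpos x).le, fun x => ?_⟩
  simp only [softmaxPol]
  rw [← Finset.sum_div, div_self (hpos x).ne']

theorem IsPolicy.le_one {f : X → A → ℝ} (hf : IsPolicy f) (x : X) (a : A) : f x a ≤ 1 := by
  rw [← hf.2 x]
  exact Finset.single_le_sum (fun b _ => hf.1 x b) (Finset.mem_univ a)

theorem isPolicy_explorePol [Nonempty A] {η : ℝ} (h0 : 0 ≤ η) (h1 : η ≤ 1) (θ : X → A → ℝ) :
    IsPolicy (explorePol η θ) := by
  have hs := isPolicy_softmaxPol θ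
  refine ⟨fun x a => ?_, fun x => ?_⟩
  · have := hs.1 x a
    unfold explorePol
    have : 0 ≤ 1 - η := by linarith
    positivity
  · simp only [explorePol]
    rw [Finset.sum_add_distrib, ← Finset.mul_sum, hs.2 x]
    have : (Fintype.card A : ℝ) ≠ 0 := by simp
    simp
    field_simp
    ring

theorem abs_inv_card_sub_softmaxPol_le [Nonempty A] (θ : X → A → ℝ) (x : X) (a : A) :
    |(Fintype.card A : ℝ)⁻¹ - softmaxPol θ x a| ≤ 1 := by
  have h0 := (isPolicy_softmaxPol θ).1 x a
  have h1 := (isPolicy_softmaxPol θ).le_one x a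
  have h2 : (Fintype.card A : ℝ)⁻¹ ≤ 1 := inv_le_one_of_one_le₀ (by
    exact_mod_cast Fintype.card_pos)
  have h3 : 0 ≤ (Fintype.card A : ℝ)⁻¹ := by positivity
  rw [abs_le]
  constructor <;> linarith

theorem abs_explorePol_sub_softmaxPol_le [Nonempty A] {η : ℝ} (h0 : 0 ≤ η) (θ : X → A → ℝ)
    (x : X) (a : A) : |explorePol η θ x a - softmaxPol θ x a| ≤ η := by
  have : explorePol η θ x a - softmaxPol θ x a
      = η * ((Fintype.card A : ℝ)⁻¹ - softmaxPol θ x a) := by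
    unfold explorePol; ring
  rw [this, abs_mul, abs_of_nonneg h0]
  exact mul_le_of_le_one_right h0 (abs_inv_card_sub_softmaxPol_le θ x a)

theorem abs_explorePol_sub_explorePol_le [Nonempty A] {η η' : ℝ} (h0 : 0 ≤ η') (h1 : η' ≤ 1)
    (θ θ' : X → A → ℝ) (x : X) (a : A) :
    |explorePol η θ x a - explorePol η' θ' x a|
      ≤ |η - η'| + |softmaxPol θ x a - softmaxPol θ' x a| := by
  have : explorePol η θ x a - explorePol η' θ' x a
      = (η - η') * ((Fintype.card A : ℝ)⁻¹ - softmaxPol θ x a)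
        + (1 - η') * (softmaxPol θ x a - softmaxPol θ' x a) := by
    unfold explorePol; ring
  rw [this]
  refine (abs_add_le _ _).trans (add_le_add ?_ ?_)
  · rw [abs_mul]
    exact mul_le_of_le_one_right (abs_nonneg _) (abs_inv_card_sub_softmaxPol_le θ x a)
  · rw [abs_mul, abs_of_nonneg (by linarith : 0 ≤ 1 - η')]
    exact mul_le_of_le_one_left (abs_nonneg _) (by linarith)

theorem hasDerivAt_softmaxPol [Nonempty A] {φ : ℝ → X → A → ℝ} {φ' : X → A → ℝ} {t : ℝ}
    (hφ : ∀ x a, HasDerivAt (fun s => φ s x a) (φ' x a) t) (x : X) (a : A) :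
    HasDerivAt (fun s => softmaxPol (φ s) x a)
      (softmaxPol (φ t) x a * (φ' x a - ∑ b, softmaxPol (φ t) x b * φ' x b)) t := by
  have hpos : 0 < ∑ a', Real.exp (φ t x a') :=
    Finset.sum_pos (fun a _ => Real.exp_pos _) Finset.univ_nonempty
  have h := ((hφ x a).exp).fun_div (HasDerivAt.fun_sum fun b (_ : b ∈ Finset.univ) => (hφ x b).exp)
    hpos.ne'
  refine h.congr_deriv ?_
  have : ∑ b, softmaxPol (φ t) x b * φ' x b
      = (∑ b, Real.exp (φ t x b) * φ' x b) / ∑ a', Real.exp (φ t x a') := by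
    rw [Finset.sum_div]
    exact Finset.sum_congr rfl fun b _ => by simp only [softmaxPol]; ring
  rw [this, softmaxPol]
  field_simp

/-- The advantage of the action-value table `q` under the policy `f`. -/
def advantage (f q : X → A → ℝ) (x : X) (a : A) : ℝ :=
  q x a - ∑ a', q x a' * f x a'

theorem abs_advantage_le {f q : X → A → ℝ} (hf : IsPolicy f) {M : ℝ} (hq : ∀ x a, |q x a| ≤ M)
    (x : X) (a : A) : |advantage f q x a| ≤ 2 * M := by
  have h : |∑ a', q x a' * f x a'| ≤ M := by
    simp_rw [mul_comm (q x _)]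
    exact abs_sum_mul_le_of_sum_eq_one (hf.1 x) (hf.2 x) (hq x)
  calc _ ≤ |q x a| + |∑ a', q x a' * f x a'| := abs_sub _ _
    _ ≤ 2 * M := by linarith [hq x a]

theorem advantage_sub (f q q' : X → A → ℝ) (x : X) (a : A) :
    advantage f q x a - advantage f q' x a = advantage f (fun x a => q x a - q' x a) x a := by
  simp only [advantage, sub_mul, Finset.sum_sub_distrib]
  ring

theorem abs_advantage_sub_le {f f' q : X → A → ℝ} {M D : ℝ} (hM : 0 ≤ M)
    (hq : ∀ x a, |q x a| ≤ M) (hD : ∀ x a, |f x a - f' x a| ≤ D) (x : X) (a : A) :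
    |advantage f q x a - advantage f' q x a| ≤ Fintype.card A * D * M := by
  have h : advantage f q x a - advantage f' q x a = - ∑ b, (f x b - f' x b) * q x b := by
    simp only [advantage, sub_mul, Finset.sum_sub_distrib]
    simp_rw [mul_comm (q x _)]
    ring
  rw [h, abs_neg]
  refine abs_sum_mul_le_sum_abs_mul hM (hq x) ?_
  calc ∑ b, |f x b - f' x b| ≤ ∑ _b : A, D := Finset.sum_le_sum fun b _ => hD x b
    _ = Fintype.card A * D := by simp

variable [Fintype X]

theorem abs_transition_average_le {p : X → A → X → ℝ} (hp0 : ∀ x a x', 0 ≤ p x a x')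
    (hp1 : ∀ x a, ∑ x', p x a x' = 1) {f h : X → A → ℝ} (hf : IsPolicy f) {M : ℝ}
    (hh : ∀ x a, |h x a| ≤ M) (x : X) (a : A) :
    |∑ x', p x a x' * ∑ a', f x' a' * h x' a'| ≤ M :=
  abs_sum_mul_le_of_sum_eq_one (hp0 x a) (hp1 x a) fun x' =>
    abs_sum_mul_le_of_sum_eq_one (hf.1 x') (hf.2 x') (hh x')

theorem abs_le_of_discounted_bound [Nonempty X] [Nonempty A] {p : X → A → X → ℝ}
    (hp0 : ∀ x a x', 0 ≤ p x a x') (hp1 : ∀ x a, ∑ x', p x a x' = 1) {γ c : ℝ} (hγ0 : 0 ≤ γ)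
    (hγ1 : γ < 1) {f h : X → A → ℝ} (hf : IsPolicy f)
    (hh : ∀ x a, |h x a| ≤ γ * |∑ x', p x a x' * ∑ a', f x' a' * h x' a'| + c) (x : X) (a : A) :
    |h x a| ≤ (1 - γ)⁻¹ * c := by
  obtain ⟨ξ, hξ⟩ := Finite.exists_max fun ξ : X × A => |h ξ.1 ξ.2|
  refine (hξ (x, a)).trans ?_
  have h1 := abs_transition_average_le hp0 hp1 hf (fun x a => hξ (x, a)) ξ.1 ξ.2
  have h2 := hh ξ.1 ξ.2
  have h3 : 0 < 1 - γ := by linarith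
  rw [← div_eq_inv_mul, le_div_iff₀ h3]
  nlinarith

/-- `q` solves the Bellman equation of the policy `f`. -/
def IsActionValue (p : X → A → X → ℝ) (r : X → A → ℝ) (γ : ℝ) (f q : X → A → ℝ) : Prop :=
  ∀ x a, q x a = r x a + γ * ∑ x', p x a x' * ∑ a', f x' a' * q x' a'

theorem IsActionValue.abs_le [Nonempty X] [Nonempty A] {p : X → A → X → ℝ} {r : X → A → ℝ}
    {γ : ℝ} {f q : X → A → ℝ} (hq : IsActionValue p r γ f q)
    (hp0 : ∀ x a x', 0 ≤ p x a x') (hp1 : ∀ x a, ∑ x', p x a x' = 1)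
    (hr : ∀ x a, 0 ≤ r x a ∧ r x a ≤ 1) (hγ0 : 0 ≤ γ) (hγ1 : γ < 1) (hf : IsPolicy f)
    (x : X) (a : A) : |q x a| ≤ (1 - γ)⁻¹ := by
  rw [← mul_one (1 - γ)⁻¹]
  refine abs_le_of_discounted_bound hp0 hp1 hγ0 hγ1 hf (fun x a => ?_) x a
  conv_lhs => rw [hq x a]
  refine (abs_add_le _ _).trans ?_
  rw [abs_mul, abs_of_nonneg hγ0, add_comm]
  gcongr
  rw [abs_of_nonneg (hr x a).1]
  exact (hr x a).2

theorem IsActionValue.abs_sub_le [Nonempty X] [Nonempty A] {p : X → A → X → ℝ} {r : X → A → ℝ}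
    {γ : ℝ} {f q f' q' : X → A → ℝ} (hq : IsActionValue p r γ f q)
    (hq' : IsActionValue p r γ f' q')
    (hp0 : ∀ x a x', 0 ≤ p x a x') (hp1 : ∀ x a, ∑ x', p x a x' = 1)
    (hr : ∀ x a, 0 ≤ r x a ∧ r x a ≤ 1) (hγ0 : 0 ≤ γ) (hγ1 : γ < 1) (hf : IsPolicy f)
    (hf' : IsPolicy f') {D : ℝ} (hD : ∀ x a, |f x a - f' x a| ≤ D) (x : X) (a : A) :
    |q x a - q' x a| ≤ (1 - γ)⁻¹ * (Fintype.card A * D * (1 - γ)⁻¹) := by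
  have hc : 0 ≤ (1 - γ)⁻¹ := inv_nonneg.2 (by linarith)
  refine abs_le_of_discounted_bound (h := fun x a => q x a - q' x a) hp0 hp1 hγ0 hγ1 hf
    (fun x a => ?_) x a
  have h1 : q x a - q' x a = γ * ∑ x', p x a x' * ∑ a', f x' a' * (q x' a' - q' x' a')
      + γ * ∑ x', p x a x' * ∑ a', (f x' a' - f' x' a') * q' x' a' := by
    rw [hq x a, hq' x a, ← mul_add, ← Finset.sum_add_distrib, add_sub_add_left_eq_sub, ← mul_sub,
      ← Finset.sum_sub_distrib]
    congr 1
    refine Finset.sum_congr rfl fun x' _ => ?_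
    rw [← mul_add, ← mul_sub, ← Finset.sum_add_distrib, ← Finset.sum_sub_distrib]
    congr 1
    exact Finset.sum_congr rfl fun a' _ => by ring
  have h2 : |∑ x', p x a x' * ∑ a', (f x' a' - f' x' a') * q' x' a'|
      ≤ Fintype.card A * D * (1 - γ)⁻¹ := by
    refine abs_sum_mul_le_of_sum_eq_one (hp0 x a) (hp1 x a) fun x' => ?_
    refine abs_sum_mul_le_sum_abs_mul hc
      (fun a' => hq'.abs_le hp0 hp1 hr hγ0 hγ1 hf' x' a') ?_
    calc ∑ a', |f x' a' - f' x' a'| ≤ ∑ _a' : A, D := Finset.sum_le_sum fun a' _ => hD x' a'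
      _ = Fintype.card A * D := by simp
  rw [h1]
  refine (abs_add_le _ _).trans ?_
  rw [abs_mul, abs_mul, abs_of_nonneg hγ0]
  exact add_le_add le_rfl ((mul_le_of_le_one_left (abs_nonneg _) hγ1.le).trans h2)

theorem stationary_actorKer_sum_mul {p : X → A → X → ℝ} {μ : X → ℝ} {γ : ℝ} {f : X → A → ℝ}
    {d : X × A → ℝ} (hd : IsStationaryDist (actorKer γ p μ f) d) (hf : IsPolicy f) (u : X → ℝ) :
    ∑ x, (∑ a, d (x, a)) * u x
      = γ * ∑ ξ, d ξ * ∑ x', p ξ.1 ξ.2 x' * u x' + (1 - γ) * ∑ x, μ x * u x := by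
  have h1 : ∀ x, ∑ a, d (x, a) = γ * ∑ ξ, d ξ * p ξ.1 ξ.2 x + (1 - γ) * μ x := by
    intro x
    calc ∑ a, d (x, a) = ∑ a, (∑ ξ, d ξ * ptilde γ p μ ξ.1 ξ.2 x) * f x a := by
          refine Finset.sum_congr rfl fun a _ => ?_
          rw [hd.2.2 (x, a), Finset.sum_mul]
          exact Finset.sum_congr rfl fun ξ _ => by simp only [actorKer]; ring
      _ = ∑ ξ, d ξ * ptilde γ p μ ξ.1 ξ.2 x := by rw [← Finset.mul_sum, hf.2, mul_one]
      _ = γ * ∑ ξ, d ξ * p ξ.1 ξ.2 x + (∑ ξ, d ξ) * ((1 - γ) * μ x) := by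
          rw [Finset.mul_sum, Finset.sum_mul, ← Finset.sum_add_distrib]
          exact Finset.sum_congr rfl fun ξ _ => by simp only [ptilde]; ring
      _ = _ := by rw [hd.2.1, one_mul]
  have h2 : ∑ ξ, d ξ * ∑ x', p ξ.1 ξ.2 x' * u x'
      = ∑ x, (∑ ξ, d ξ * p ξ.1 ξ.2 x) * u x := by
    simp_rw [Finset.mul_sum, Finset.sum_mul]
    rw [Finset.sum_comm]
    exact Finset.sum_congr rfl fun x _ => Finset.sum_congr rfl fun ξ _ => by ring
  rw [h2, Finset.mul_sum, Finset.mul_sum, ← Finset.sum_add_distrib]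
  exact Finset.sum_congr rfl fun x _ => by rw [h1 x]; ring

theorem stationary_actorKer_apply {p : X → A → X → ℝ} {μ : X → ℝ} {γ : ℝ} {f : X → A → ℝ}
    {d : X × A → ℝ} (hd : IsStationaryDist (actorKer γ p μ f) d) (hf : IsPolicy f) (x : X)
    (a : A) : d (x, a) = (∑ a', d (x, a')) * f x a := by
  have h : ∀ a, d (x, a) = (∑ ξ, d ξ * ptilde γ p μ ξ.1 ξ.2 x) * f x a := fun a => by
    rw [hd.2.2 (x, a), Finset.sum_mul]
    exact Finset.sum_congr rfl fun ξ _ => by simp only [actorKer]; ring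
  have h2 : ∑ a', d (x, a') = ∑ ξ, d ξ * ptilde γ p μ ξ.1 ξ.2 x := by
    rw [Finset.sum_congr rfl fun a' _ => h a', ← Finset.mul_sum, hf.2, mul_one]
  rw [h2, h a]

theorem performance_difference {p : X → A → X → ℝ} {μ : X → ℝ} {r : X → A → ℝ} {γ : ℝ}
    {f q f' q' : X → A → ℝ} {d' : X × A → ℝ}
    (hd' : IsStationaryDist (actorKer γ p μ f') d') (hf' : IsPolicy f')
    (hq : IsActionValue p r γ f q) (hq' : IsActionValue p r γ f' q') :
    (1 - γ) * (∑ x, μ x * ∑ a, f' x a * q' x a - ∑ x, μ x * ∑ a, f x a * q x a)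
      = ∑ x, (∑ a, d' (x, a)) * ∑ a, (f' x a - f x a) * q x a := by
  have hprod : ∀ h : X → A → ℝ, ∑ x, (∑ a, d' (x, a)) * ∑ a, f' x a * h x a
      = ∑ ξ, d' ξ * h ξ.1 ξ.2 := by
    intro h
    rw [Fintype.sum_prod_type]
    refine Finset.sum_congr rfl fun x _ => ?_
    rw [Finset.mul_sum]
    refine Finset.sum_congr rfl fun a _ => ?_
    rw [stationary_actorKer_apply hd' hf' x a]; ring
  have hres : ∀ g h : X → A → ℝ, IsActionValue p r γ g h →
      γ * ∑ ξ, d' ξ * ∑ x', p ξ.1 ξ.2 x' * ∑ a', g x' a' * h x' a'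
        = ∑ ξ, d' ξ * h ξ.1 ξ.2 - ∑ ξ, d' ξ * r ξ.1 ξ.2 := by
    intro g h hh
    rw [← Finset.sum_sub_distrib, Finset.mul_sum]
    refine Finset.sum_congr rfl fun ξ _ => ?_
    rw [hh ξ.1 ξ.2]; ring
  have h1 := stationary_actorKer_sum_mul hd' hf' fun x => ∑ a, f' x a * q' x a
  have h2 := stationary_actorKer_sum_mul hd' hf' fun x => ∑ a, f x a * q x a
  rw [hprod, hres f' q' hq'] at h1
  rw [hres f q hq] at h2
  have h3 : ∑ x, (∑ a, d' (x, a)) * ∑ a, (f' x a - f x a) * q x a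
      = ∑ ξ, d' ξ * q ξ.1 ξ.2 - ∑ x, (∑ a, d' (x, a)) * ∑ a, f x a * q x a := by
    rw [← hprod q, ← Finset.sum_sub_distrib]
    refine Finset.sum_congr rfl fun x _ => ?_
    rw [← mul_sub, ← Finset.sum_sub_distrib]
    simp_rw [sub_mul]
  rw [h3]
  linarith

theorem hasDerivAt_return_softmaxPol [Nonempty A] {p : X → A → X → ℝ} {μ : X → ℝ}
    {r : X → A → ℝ} {γ : ℝ} (hγ1 : γ < 1) {sigsta : (X → A → ℝ) → X × A → ℝ}
    (hsig : ∀ θ : X → A → ℝ,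
      IsStationaryDist (actorKer γ p μ (softmaxPol θ)) (sigsta (softmaxPol θ)))
    (hsigLip : ∃ L : ℝ, ∀ f f' : X → A → ℝ,
      ∑ ξ : X × A, |sigsta f ξ - sigsta f' ξ| ≤ L * ∑ x, ∑ a, |f x a - f' x a|)
    {Vq : (X → A → ℝ) → X → A → ℝ}
    (hVq : ∀ f : X → A → ℝ, IsPolicy f → IsActionValue p r γ f (Vq f))
    {J : (X → A → ℝ) → ℝ}
    (hJ : ∀ f : X → A → ℝ, IsPolicy f → J f = ∑ x, μ x * ∑ a, f x a * Vq f x a)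
    {φ : ℝ → X → A → ℝ} {φ' : X → A → ℝ} {t : ℝ}
    (hφ : ∀ x a, HasDerivAt (fun s => φ s x a) (φ' x a) t) :
    HasDerivAt (fun s => J (softmaxPol (φ s)))
      ((1 - γ)⁻¹ * ∑ x, ∑ a, sigsta (softmaxPol (φ t)) (x, a)
        * advantage (softmaxPol (φ t)) (Vq (softmaxPol (φ t))) x a * φ' x a) t := by
  have hγ : 1 - γ ≠ 0 := by linarith
  set f := softmaxPol (φ t) with hf
  set q := Vq f
  have hpol : ∀ s, IsPolicy (softmaxPol (φ s)) := fun s => isPolicy_softmaxPol _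
  have hfd := hasDerivAt_softmaxPol hφ
  have hcont : ∀ ξ, ContinuousAt (fun s => sigsta (softmaxPol (φ s)) ξ) t := by
    obtain ⟨L, hL⟩ := hsigLip
    intro ξ
    rw [ContinuousAt, tendsto_iff_norm_sub_tendsto_zero]
    have hlim : Tendsto (fun s => L * ∑ x, ∑ a, |softmaxPol (φ s) x a - f x a|) (nhds t)
        (nhds (L * ∑ x : X, ∑ a : A, |f x a - f x a|)) :=
      (tendsto_finsetSum _ fun x _ => tendsto_finsetSum _ fun a _ =>
        ((hfd x a).continuousAt.tendsto.sub_const (f x a)).abs).const_mul L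
    simp only [sub_self, abs_zero, Finset.sum_const_zero, mul_zero] at hlim
    refine squeeze_zero (fun _ => norm_nonneg _) (fun s => ?_) hlim
    refine le_trans ?_ (hL (softmaxPol (φ s)) f)
    exact Finset.single_le_sum
      (f := fun ξ => |sigsta (softmaxPol (φ s)) ξ - sigsta f ξ|)
      (fun _ _ => abs_nonneg _) (Finset.mem_univ ξ)
  have hrep : (fun s => J (softmaxPol (φ s))) = fun s => J f + (1 - γ)⁻¹ *
      ∑ x, (∑ a, sigsta (softmaxPol (φ s)) (x, a)) *
        ∑ a, (softmaxPol (φ s) x a - f x a) * q x a := by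
    funext s
    have h := performance_difference (hsig (φ s)) (hpol s) (hVq f (hpol t)) (hVq _ (hpol s))
    rw [← hJ _ (hpol s), ← hJ _ (hpol t)] at h
    rw [← h]
    field_simp
    ring
  rw [hrep]
  have hterm : ∀ x, HasDerivAt (fun s => (∑ a, sigsta (softmaxPol (φ s)) (x, a)) *
      ∑ a, (softmaxPol (φ s) x a - f x a) * q x a)
      ((∑ a, sigsta f (x, a)) *
        ∑ a, f x a * (φ' x a - ∑ b, f x b * φ' x b) * q x a) t := by
    intro x
    refine hasDerivAt_mul_of_eq_zero
      (D := fun s => ∑ a, sigsta (softmaxPol (φ s)) (x, a)) ?_ ?_ ?_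
    · exact tendsto_finsetSum _ fun a _ => hcont (x, a)
    · exact HasDerivAt.fun_sum fun a _ => ((hfd x a).sub_const (f x a)).mul_const (q x a)
    · simp [← hf]
  have hsum := ((HasDerivAt.fun_sum fun x (_ : x ∈ Finset.univ) => hterm x).const_mul
    (1 - γ)⁻¹).const_add (J f)
  refine hsum.congr_deriv ?_
  congr 1
  refine Finset.sum_congr rfl fun x _ => ?_
  have h1 : ∑ a, f x a * (φ' x a - ∑ b, f x b * φ' x b) * q x a
      = ∑ a, f x a * advantage f q x a * φ' x a := by
    have e1 : ∑ a, f x a * (φ' x a - ∑ b, f x b * φ' x b) * q x a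
        = ∑ a, f x a * φ' x a * q x a - (∑ b, f x b * φ' x b) * ∑ a, q x a * f x a := by
      rw [Finset.mul_sum, ← Finset.sum_sub_distrib]
      exact Finset.sum_congr rfl fun a _ => by ring
    have e2 : ∑ a, f x a * advantage f q x a * φ' x a
        = ∑ a, f x a * φ' x a * q x a - (∑ b, f x b * φ' x b) * ∑ a, q x a * f x a := by
      rw [Finset.sum_mul, ← Finset.sum_sub_distrib]
      exact Finset.sum_congr rfl fun a _ => by simp only [advantage]; ring
    rw [e1, e2]
  rw [h1, Finset.mul_sum]
  refine Finset.sum_congr rfl fun a _ => ?_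
  rw [stationary_actorKer_apply (hsig (φ t)) (hpol t) x a]
  ring

theorem stationary_kpow {S : Type*} [Fintype S] [DecidableEq S] {K : S → S → ℝ} {d : S → ℝ}
    (hd : IsStationaryDist K d) (n : ℕ) (ξ' : S) : d ξ' = ∑ ξ, d ξ * kpow K n ξ ξ' := by
  induction n with
  | zero => simp [kpow]
  | succ n ih =>
    rw [ih]
    simp only [kpow, Finset.mul_sum]
    rw [Finset.sum_comm]
    refine Finset.sum_congr rfl fun y _ => ?_
    conv_lhs => rw [hd.2.2 y, Finset.sum_mul]
    exact Finset.sum_congr rfl fun ξ _ => by ring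

theorem pow_mul_kpow_le {S : Type*} [Fintype S] [DecidableEq S] {K K' : S → S → ℝ} {η : ℝ}
    (hη : 0 ≤ η) (hK : ∀ ξ ξ', 0 ≤ K ξ ξ') (hKK' : ∀ ξ ξ', η * K ξ ξ' ≤ K' ξ ξ') (n : ℕ) :
    ∀ ξ ξ', 0 ≤ kpow K n ξ ξ' ∧ η ^ n * kpow K n ξ ξ' ≤ kpow K' n ξ ξ' := by
  induction n with
  | zero => intro ξ ξ'; simp only [kpow]; split_ifs <;> simp
  | succ n ih =>
    intro ξ ξ'
    simp only [kpow]
    refine ⟨Finset.sum_nonneg fun y _ => mul_nonneg (hK _ _) (ih _ _).1, ?_⟩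
    rw [Finset.mul_sum]
    refine Finset.sum_le_sum fun y _ => ?_
    calc η ^ (n + 1) * (K ξ y * kpow K n y ξ') = (η * K ξ y) * (η ^ n * kpow K n y ξ') := by ring
      _ ≤ K' ξ y * kpow K' n y ξ' :=
        mul_le_mul (hKK' _ _) (ih _ _).2 (mul_nonneg (pow_nonneg hη n) (ih _ _).1)
          ((mul_nonneg hη (hK _ _)).trans (hKK' _ _))

theorem exists_lower_bound_stationary_explorePol [Nonempty X] [Nonempty A] [DecidableEq X]
    [DecidableEq A] {p : X → A → X → ℝ} (hp0 : ∀ x a x', 0 ≤ p x a x')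
    {pista : (X → A → ℝ) → X × A → ℝ}
    (hpi : ∀ (η : ℝ) (θ : X → A → ℝ), 0 ≤ η → η < 1 →
      IsStationaryDist (criticKer p (explorePol η θ)) (pista (explorePol η θ)))
    (hergC : ∀ (η : ℝ) (θ : X → A → ℝ), 0 ≤ η → η < 1 → ∃ n, 0 < n ∧
      ∀ ξ ξ' : X × A, 0 < kpow (criticKer p (explorePol η θ)) n ξ ξ') :
    ∃ c : ℝ, 0 < c ∧ ∃ n : ℕ, ∀ (η : ℝ) (θ : X → A → ℝ), 0 ≤ η → η < 1 → ∀ ξ,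
      c * η ^ n ≤ pista (explorePol η θ) ξ := by
  obtain ⟨n, -, hn⟩ := hergC 0 (fun _ _ => 0) le_rfl one_pos
  set u : X → A → ℝ := explorePol 0 (fun _ _ => 0) with hu
  obtain ⟨ζ, hζ⟩ := Finite.exists_min fun z : (X × A) × (X × A) =>
    kpow (criticKer p u) n z.1 z.2
  refine ⟨_, hn ζ.1 ζ.2, n, fun η θ h0 h1 ξ' => ?_⟩
  have hst := hpi η θ h0 h1
  have hupol : IsPolicy u := isPolicy_explorePol le_rfl zero_le_one _
  have hdom := (pow_mul_kpow_le (K := criticKer p u) (K' := criticKer p (explorePol η θ)) h0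
    (fun ξ ξ' => mul_nonneg (hp0 _ _ _) (hupol.1 _ _)) (fun ξ ξ' => by
      have hval : u ξ'.1 ξ'.2 = (Fintype.card A : ℝ)⁻¹ := by
        simp [hu, explorePol, softmaxPol]
      have hle : η * u ξ'.1 ξ'.2 ≤ explorePol η θ ξ'.1 ξ'.2 := by
        rw [hval, explorePol, ← div_eq_mul_inv]
        have := mul_nonneg (sub_nonneg.2 h1.le) ((isPolicy_softmaxPol θ).1 ξ'.1 ξ'.2)
        linarith
      simp only [criticKer]
      calc η * (p ξ.1 ξ.2 ξ'.1 * u ξ'.1 ξ'.2) = p ξ.1 ξ.2 ξ'.1 * (η * u ξ'.1 ξ'.2) := by ring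
        _ ≤ _ := mul_le_mul_of_nonneg_left hle (hp0 _ _ _)) n)
  rw [stationary_kpow hst n ξ']
  calc kpow (criticKer p u) n ζ.1 ζ.2 * η ^ n
      = ∑ ξ, pista (explorePol η θ) ξ * (η ^ n * kpow (criticKer p u) n ζ.1 ζ.2) := by
        rw [← Finset.sum_mul, hst.2.1]; ring
    _ ≤ _ := Finset.sum_le_sum fun ξ _ => mul_le_mul_of_nonneg_left
        ((mul_le_mul_of_nonneg_left (hζ (ξ, ξ')) (pow_nonneg h0 n)).trans (hdom ξ ξ').2)
        (hst.1 ξ)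

theorem IsStationaryDist.le_one {S : Type*} [Fintype S] {K : S → S → ℝ} {d : S → ℝ}
    (hd : IsStationaryDist K d) (ξ : S) : d ξ ≤ 1 := by
  rw [← hd.2.1]
  exact Finset.single_le_sum (fun b _ => hd.1 b) (Finset.mem_univ ξ)

end DecisionProcess

section Critic

variable {X A : Type*}

theorem continuousOn_uncurry_of_hasDerivAt {Q Q' : ℝ → X → A → ℝ}
    (hQ : ∀ t, 0 ≤ t → ∀ x a, HasDerivAt (fun s => Q s x a) (Q' t x a) t) :
    ContinuousOn (fun t (ξ : X × A) => Q t ξ.1 ξ.2) (Ici 0) :=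
  continuousOn_pi.2 fun ξ t ht => (hQ t ht ξ.1 ξ.2).continuousAt.continuousWithinAt

variable [Fintype X] [Fintype A]

theorem continuousOn_of_log_lipschitz {u : ℝ → ℝ} {K : ℝ}
    (hu : ∀ s t, 0 ≤ s → s ≤ t → |u t - u s| ≤ K * (Real.log (t + 1) - Real.log (s + 1))) :
    ContinuousOn u (Ici 0) := by
  intro t ht
  have hlog : ContinuousAt (fun s => Real.log (s + 1)) t := (hasDerivAt_log_add_one ht).continuousAt
  have hlim : Tendsto (fun s => |K| * |Real.log (s + 1) - Real.log (t + 1)|) (nhds t) (nhds 0) := by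
    simpa using ((hlog.tendsto.sub_const (Real.log (t + 1))).abs).const_mul |K|
  rw [ContinuousWithinAt, tendsto_iff_norm_sub_tendsto_zero]
  refine squeeze_zero' (.of_forall fun _ => norm_nonneg _) ?_ (hlim.mono_left nhdsWithin_le_nhds)
  filter_upwards [self_mem_nhdsWithin] with s hs
  rw [Real.norm_eq_abs, ← abs_mul]
  rcases le_total s t with h | h
  · rw [abs_sub_comm]
    refine (hu s t hs h).trans ((le_abs_self _).trans_eq ?_)
    rw [abs_mul, abs_mul, abs_sub_comm]
  · exact (hu t s ht h).trans (le_abs_self _)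

theorem sum_mul_transition_eq (p : X → A → X → ℝ) (f q : X → A → ℝ) (x : X) (a : A) :
    ∑ z, ∑ b, q z b * f z b * p x a z = ∑ z, p x a z * ∑ b, f z b * q z b := by
  refine Finset.sum_congr rfl fun z _ => ?_
  rw [Finset.mul_sum]
  exact Finset.sum_congr rfl fun b _ => by ring

theorem mul_le_of_abs_eq_one {c y M : ℝ} (hc : |c| = 1) (hy : |y| ≤ M) : c * y ≤ M := by
  calc c * y ≤ |c * y| := le_abs_self _
    _ = |y| := by rw [abs_mul, hc, one_mul]
    _ ≤ M := hy

variable {p : X → A → X → ℝ} {r : X → A → ℝ} {γ α : ℝ} {Q g : ℝ → X → A → ℝ}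
  {w : ℝ → X × A → ℝ}

theorem exists_bound_critic
    (hp0 : ∀ x a x', 0 ≤ p x a x') (hp1 : ∀ x a, ∑ x', p x a x' = 1)
    (hr : ∀ x a, 0 ≤ r x a ∧ r x a ≤ 1) (hγ : 0 < γ ∧ γ < 1) (hα : 0 < α)
    (hw : ∀ t, 0 < t → ∀ ξ, 0 ≤ w t ξ) (hg : ∀ t, 0 ≤ t → IsPolicy (g t))
    (hQ : ∀ t, 0 ≤ t → ∀ x a, HasDerivAt (fun s => Q s x a)
      (α * w t (x, a) *
        (r x a + γ * (∑ z, ∑ b, Q t z b * g t z b * p x a z) - Q t x a)) t) :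
    ∃ M : ℝ, 0 ≤ M ∧ ∀ t, 0 ≤ t → ∀ x a, |Q t x a| ≤ M := by
  set N : ℝ := ‖fun ξ : X × A => Q 0 ξ.1 ξ.2‖ with hN
  have hN0 : 0 ≤ N := norm_nonneg _
  have hc : 0 < (1 - γ)⁻¹ := inv_pos.2 (by linarith [hγ.2])
  set M : ℝ := (1 - γ)⁻¹ + 2 + N with hM
  have hζd : ∀ t : ℝ, 0 ≤ t → HasDerivAt (fun s => M - zetaT s) (((1 + t) ^ 2)⁻¹) t := by
    intro t ht
    have := (((hasDerivAt_id t).const_add 1).inv (by simp; positivity)).const_sub M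
    refine this.congr_deriv ?_
    simp [div_eq_mul_inv]
  have hζ1 : ∀ t : ℝ, 0 ≤ t → zetaT t ≤ 1 := fun t ht =>
    inv_le_one_of_one_le₀ (by linarith)
  have hlt := norm_sub_lt_of_barrier (a := 0) (K := 0)
    (Q := fun t (ξ : X × A) => Q t ξ.1 ξ.2) (R := fun _ _ => 0) (Z := fun _ => 0) (Z' := fun _ => 0)
    (B := fun t => M - zetaT t) (B' := fun t => ((1 + t) ^ 2)⁻¹)
    (continuousOn_uncurry_of_hasDerivAt hQ)
    continuousOn_const (fun t ht => (hζd t ht).continuousAt.continuousWithinAt)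
    (fun t ht ξ => hQ t ht.le ξ.1 ξ.2) (fun t ht => hζd t ht.le) (fun t _ => hasDerivAt_const t 0)
    (fun t ht => by linarith [hζ1 t ht]) (by simp)
    (fun ξ => by
      have h1 : |Q 0 ξ.1 ξ.2| ≤ N := norm_le_pi_norm (fun ξ : X × A => Q 0 ξ.1 ξ.2) ξ
      have h2 := hζ1 0 le_rfl
      simp only [sub_zero]
      linarith)
    (fun t ht hall ξ c hc1 hcB => by
      simp only [sub_zero] at hall hcB ⊢
      have hB : (1 - γ)⁻¹ ≤ M - zetaT t := by linarith [hζ1 t ht.le]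
      have hB' : 1 ≤ (1 - γ) * (M - zetaT t) := by
        have h1 : 0 < 1 - γ := by linarith [hγ.2]
        calc 1 = (1 - γ) * (1 - γ)⁻¹ := (mul_inv_cancel₀ h1.ne').symm
          _ ≤ _ := by gcongr
      have h1 := mul_le_of_abs_eq_one hc1
        (abs_transition_average_le hp0 hp1 (hg t ht.le) (fun x a => hall (x, a)) ξ.1 ξ.2)
      have h2 : c * r ξ.1 ξ.2 ≤ 1 := mul_le_of_abs_eq_one hc1 (by
        rw [abs_of_nonneg (hr _ _).1]; exact (hr _ _).2)
      rw [sum_mul_transition_eq]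
      have h3 : c * (r ξ.1 ξ.2 + γ * ∑ z, p ξ.1 ξ.2 z * ∑ b, g t z b * Q t z b - Q t ξ.1 ξ.2)
          ≤ 0 := by
        have := mul_le_mul_of_nonneg_left h1 hγ.1.le
        linarith
      have h4 := mul_nonneg hα.le (hw t ht ξ)
      have h5 := mul_nonpos_of_nonneg_of_nonpos h4 h3
      have h6 : 0 < ((1 + t) ^ 2)⁻¹ := by positivity
      calc _ = α * w t ξ * (c * (r ξ.1 ξ.2
            + γ * ∑ z, p ξ.1 ξ.2 z * ∑ b, g t z b * Q t z b - Q t ξ.1 ξ.2)) := by ring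
        _ < _ := by linarith)
  refine ⟨M, by positivity, fun t ht x a => ?_⟩
  have := hlt t ht (x, a)
  simp only [sub_zero] at this
  linarith [zetaT_pos ht]

theorem exists_critic_tracking
    (hp0 : ∀ x a x', 0 ≤ p x a x') (hp1 : ∀ x a, ∑ x', p x a x' = 1)
    (hγ : 0 < γ ∧ γ < 1) (hα : 0 < α) {c₀ : ℝ} (hc₀ : 0 < c₀) {n : ℕ}
    (hw : ∀ t, 0 < t → ∀ ξ, c₀ * etaT t ^ n ≤ w t ξ) (hg : ∀ t, 0 ≤ t → IsPolicy (g t))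
    (hQ : ∀ t, 0 ≤ t → ∀ x a, HasDerivAt (fun s => Q s x a)
      (α * w t (x, a) *
        (r x a + γ * (∑ z, ∑ b, Q t z b * g t z b * p x a z) - Q t x a)) t)
    {R : ℝ → X → A → ℝ} (hR : ∀ t, 0 ≤ t → IsActionValue p r γ (g t) (R t)) {K : ℝ}
    (hRLip : ∀ s t, 0 ≤ s → s ≤ t → ∀ x a,
      |R t x a - R s x a| ≤ K * (Real.log (t + 1) - Real.log (s + 1))) :
    ∃ C T : ℝ, 0 ≤ C ∧ 0 ≤ T ∧ ∀ t, T ≤ t → ∀ x a, |Q t x a - R t x a| ≤ C * etaT t := by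
  have hγ1 : 0 < 1 - γ := by linarith [hγ.2]
  have hev := eventually_zetaT_lt (n + 1) (κ := α * c₀ * (1 - γ)) (K := |K| + 1) (by positivity)
  obtain ⟨T₀, hT₀⟩ := eventually_atTop.1 hev
  set T := max T₀ 0 with hT
  have hT0 : 0 ≤ T := le_max_right _ _
  set N : ℝ := ‖fun ξ : X × A => Q T ξ.1 ξ.2 - R T ξ.1 ξ.2‖ with hN
  have hN0 : 0 ≤ N := norm_nonneg _
  set C : ℝ := 1 + N / etaT T with hC
  have hC1 : 1 ≤ C := le_add_of_nonneg_right (div_nonneg hN0 (etaT_pos T).le)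
  have hsub : Ici T ⊆ Ici (0 : ℝ) := Ici_subset_Ici.2 hT0
  have hBd : ∀ t, 0 ≤ t → HasDerivAt (fun s => C * etaT s) (C * deriv etaT t) t := fun t ht => by
    obtain ⟨η', h, -⟩ := hasDerivAt_etaT ht
    rw [h.deriv]
    exact h.const_mul C
  have hlt := norm_sub_lt_of_barrier (a := T) (K := K)
    (Q := fun t (ξ : X × A) => Q t ξ.1 ξ.2) (R := fun t (ξ : X × A) => R t ξ.1 ξ.2)
    (Z := fun t => Real.log (t + 1)) (Z' := zetaT)
    (B := fun t => C * etaT t) (B' := fun t => C * deriv etaT t)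
    ((continuousOn_uncurry_of_hasDerivAt hQ).mono hsub)
    (continuousOn_pi.2 fun ξ =>
      (continuousOn_of_log_lipschitz fun s t hs hst => hRLip s t hs hst ξ.1 ξ.2).mono hsub)
    (fun t ht => (hBd t (hsub ht)).continuousAt.continuousWithinAt)
    (fun t ht ξ => hQ t (hT0.trans ht.le) ξ.1 ξ.2) (fun t ht => hBd t (hT0.trans ht.le))
    (fun t ht => hasDerivAt_log_add_one (hT0.trans ht.le))
    (fun t _ => mul_pos (by linarith) (etaT_pos t))
    (fun s t hs hst ξ => hRLip s t (hT0.trans hs) hst ξ.1 ξ.2)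
    (fun ξ => by
      have h1 : |Q T ξ.1 ξ.2 - R T ξ.1 ξ.2| ≤ N :=
        norm_le_pi_norm (fun ξ : X × A => Q T ξ.1 ξ.2 - R T ξ.1 ξ.2) ξ
      have h2 := etaT_pos T
      have h3 : C * etaT T = etaT T + N := by rw [hC]; field_simp
      rw [h3]
      linarith)
    (fun t ht hall ξ c hc1 hcB => by
      have ht0 : 0 < t := hT0.trans_lt ht
      have hsmall := hT₀ t ((le_max_left _ _).trans ht.le)
      have h1 := mul_le_of_abs_eq_one hc1
        (abs_transition_average_le (h := fun x a => Q t x a - R t x a) hp0 hp1 (hg t ht0.le)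
          (fun x a => hall (x, a)) ξ.1 ξ.2)
      have hres : r ξ.1 ξ.2 + γ * ∑ z, p ξ.1 ξ.2 z * ∑ b, g t z b * Q t z b - Q t ξ.1 ξ.2
          = γ * ∑ z, p ξ.1 ξ.2 z * ∑ b, g t z b * (Q t z b - R t z b)
            - (Q t ξ.1 ξ.2 - R t ξ.1 ξ.2) := by
        rw [hR t ht0.le ξ.1 ξ.2]
        simp only [mul_sub, Finset.sum_sub_distrib]
        ring
      have hη := etaT_pos t
      have hη1 := etaT_le_one t
      have hζ := zetaT_pos ht0.le
      obtain ⟨η', hη', hb⟩ := hasDerivAt_etaT ht0.le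
      have hb' := (abs_le.1 (hb.trans (mul_le_of_le_one_right hζ.le hη1))).1
      rw [hη'.deriv, sum_mul_transition_eq, hres]
      have h3 : c * (γ * ∑ z, p ξ.1 ξ.2 z * ∑ b, g t z b * (Q t z b - R t z b)
          - (Q t ξ.1 ξ.2 - R t ξ.1 ξ.2)) ≤ -((1 - γ) * (C * etaT t)) := by
        have := mul_le_mul_of_nonneg_left h1 hγ.1.le
        linarith
      have hw0 : 0 ≤ c₀ * etaT t ^ n := by positivity
      have h4 : α * w t ξ * (c * (γ * ∑ z, p ξ.1 ξ.2 z * ∑ b, g t z b * (Q t z b - R t z b)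
          - (Q t ξ.1 ξ.2 - R t ξ.1 ξ.2))) ≤ α * (c₀ * etaT t ^ n) * -((1 - γ) * (C * etaT t)) := by
        have hw' := hw t ht0 ξ
        calc _ ≤ α * w t ξ * -((1 - γ) * (C * etaT t)) :=
              mul_le_mul_of_nonneg_left h3 (mul_nonneg hα.le (hw0.trans hw'))
          _ ≤ _ := mul_le_mul_of_nonpos_right (mul_le_mul_of_nonneg_left hw' hα.le)
              (neg_nonpos.2 (by positivity))
      have h5 : K * zetaT t ≤ C * (|K| * zetaT t) := by
        calc K * zetaT t ≤ |K| * zetaT t := by gcongr; exact le_abs_self K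
          _ ≤ _ := le_mul_of_one_le_left (by positivity) hC1
      have h6 : C * ((|K| + 1) * zetaT t) < C * (α * c₀ * (1 - γ) * etaT t ^ (n + 1)) := by
        gcongr
      have h7 : C * -zetaT t ≤ C * η' := by gcongr
      calc _ = α * w t ξ * (c * (γ * ∑ z, p ξ.1 ξ.2 z * ∑ b, g t z b * (Q t z b - R t z b)
            - (Q t ξ.1 ξ.2 - R t ξ.1 ξ.2))) := by ring
        _ ≤ _ := h4
        _ = -(C * (α * c₀ * (1 - γ) * etaT t ^ (n + 1))) := by ring
        _ < _ := by linarith)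
  exact ⟨C, T, by linarith, hT0, fun t ht x a => (hlt t ht (x, a)).le⟩

theorem exists_tendsto_of_monotoneOn_Ici {H : ℝ → ℝ} {T b : ℝ} (hm : MonotoneOn H (Ici T))
    (hb : ∀ t, T ≤ t → H t ≤ b) : ∃ l, Tendsto H atTop (nhds l) := by
  have hmono : Monotone fun t => H (max t T) := fun s t hst =>
    hm (show max s T ∈ Ici T from le_max_right s T)
      (show max t T ∈ Ici T from le_max_right t T) (max_le_max_right T hst)
  refine ⟨_, (tendsto_atTop_ciSup hmono ⟨b, ?_⟩).congr' ?_⟩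
  · rintro _ ⟨t, rfl⟩
    exact hb _ (le_max_right _ _)
  · filter_upwards [eventually_ge_atTop T] with t ht
    rw [max_eq_left ht]

end Critic

theorem convergence_to_stationary_point
    {X A : Type*} [Fintype X] [Fintype A] [Nonempty X] [Nonempty A]
    [DecidableEq X] [DecidableEq A]
    (p : X → A → X → ℝ) (μ : X → ℝ) (r : X → A → ℝ) (γ α : ℝ)
    (hp0 : ∀ x a x', 0 ≤ p x a x') (hp1 : ∀ x a, ∑ x', p x a x' = 1)
    (hμ0 : ∀ x, 0 ≤ μ x) (hμ1 : ∑ x, μ x = 1)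
    (hr : ∀ x a, 0 ≤ r x a ∧ r x a ≤ 1) (hγ : 0 < γ ∧ γ < 1) (hα : 0 < α)
    (sigsta : (X → A → ℝ) → X × A → ℝ)
    (hsig : ∀ θ : X → A → ℝ,
      IsStationaryDist (actorKer γ p μ (softmaxPol θ)) (sigsta (softmaxPol θ)))
    (hsigLip : ∃ L : ℝ, ∀ f f' : X → A → ℝ,
      ∑ ξ : X × A, |sigsta f ξ - sigsta f' ξ| ≤ L * ∑ x, ∑ a, |f x a - f' x a|)
    (hergA : ∀ θ : X → A → ℝ, ∃ n, 0 < n ∧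
      ∀ ξ ξ' : X × A, 0 < kpow (actorKer γ p μ (softmaxPol θ)) n ξ ξ')
    (pista : (X → A → ℝ) → X × A → ℝ)
    (hpi : ∀ (η : ℝ) (θ : X → A → ℝ), 0 ≤ η → η < 1 →
      IsStationaryDist (criticKer p (explorePol η θ)) (pista (explorePol η θ)))
    (hpiLip : ∃ L : ℝ, ∀ f f' : X → A → ℝ,
      ∑ ξ : X × A, |pista f ξ - pista f' ξ| ≤ L * ∑ x, ∑ a, |f x a - f' x a|)
    (hergC : ∀ (η : ℝ) (θ : X → A → ℝ), 0 ≤ η → η < 1 → ∃ n, 0 < n ∧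
      ∀ ξ ξ' : X × A, 0 < kpow (criticKer p (explorePol η θ)) n ξ ξ')
    (Qb θb : ℝ → X → A → ℝ)
    (hQode : ∀ t, 0 ≤ t → ∀ x a, HasDerivAt (fun s => Qb s x a)
      (α * pista (explorePol (etaT t) (θb t)) (x, a) *
        (r x a + γ * (∑ z, ∑ a'', Qb t z a'' * explorePol (etaT t) (θb t) z a'' * p x a z)
          - Qb t x a)) t)
    (hθode : ∀ t, 0 ≤ t → ∀ x a, HasDerivAt (fun s => θb s x a)
      (zetaT t * sigsta (softmaxPol (θb t)) (x, a) *
        (Qb t x a - ∑ a', Qb t x a' * softmaxPol (θb t) x a')) t)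
    (Vq : (X → A → ℝ) → X → A → ℝ)
    (hVq : ∀ f : X → A → ℝ, IsPolicy f → ∀ x a,
      Vq f x a = r x a + γ * ∑ x', p x a x' * ∑ a', f x' a' * Vq f x' a')
    (J : (X → A → ℝ) → ℝ)
    (hJ : ∀ f : X → A → ℝ, IsPolicy f → J f = ∑ x, μ x * ∑ a, f x a * Vq f x a)
    (grad : (X → A → ℝ) → X → A → ℝ)
    (hgrad : ∀ (ϑ : X → A → ℝ) (x : X) (a : A), HasDerivAt
      (fun u : ℝ => J (softmaxPol (fun x' a' => if x' = x ∧ a' = a then u else ϑ x' a')))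
      (grad ϑ x a) (ϑ x a)) :
    (∃ L : ℝ, Tendsto (fun t => J (softmaxPol (θb t))) atTop (nhds L)) ∧
      ∀ x a, Tendsto (fun t => grad (θb t) x a) atTop (nhds 0) := by
  have hγ1 : 0 < 1 - γ := by linarith [hγ.2]
  set c : ℝ := (1 - γ)⁻¹ with hc
  have hc0 : 0 < c := inv_pos.2 hγ1
  have hcγ : (1 - γ) * c = 1 := mul_inv_cancel₀ hγ1.ne'
  have hval : ∀ f : X → A → ℝ, IsPolicy f → IsActionValue p r γ f (Vq f) := hVq
  have hqb : ∀ f : X → A → ℝ, IsPolicy f → ∀ x a, |Vq f x a| ≤ c := fun f hf =>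
    (hval f hf).abs_le hp0 hp1 hr hγ.1.le hγ.2 hf
  have hgp : ∀ t, 0 ≤ t → IsPolicy (explorePol (etaT t) (θb t)) := fun t _ =>
    isPolicy_explorePol (etaT_pos t).le (etaT_le_one t) _
  have hfp : ∀ t, IsPolicy (softmaxPol (θb t)) := fun t => isPolicy_softmaxPol _
  have hgradeq : ∀ ϑ x a, grad ϑ x a = c * (sigsta (softmaxPol ϑ) (x, a)
      * advantage (softmaxPol ϑ) (Vq (softmaxPol ϑ)) x a) := by
    intro ϑ x a
    have hφ : ∀ x' a', HasDerivAt (fun u : ℝ => if x' = x ∧ a' = a then u else ϑ x' a')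
        (if x' = x ∧ a' = a then 1 else 0) (ϑ x a) := by
      intro x' a'
      split_ifs
      · exact hasDerivAt_id _
      · exact hasDerivAt_const _ _
    have h := hasDerivAt_return_softmaxPol hγ.2 hsig hsigLip hval hJ
      (φ := fun u x' a' => if x' = x ∧ a' = a then u else ϑ x' a') hφ
    have hself : (fun x' a' => if x' = x ∧ a' = a then ϑ x a else ϑ x' a') = ϑ := by
      funext x' a'
      split_ifs with h
      · rw [h.1, h.2]
      · rfl
    simp only [hself] at h
    rw [(hgrad ϑ x a).unique h]
    congr 1
    rw [Finset.sum_eq_single x, Finset.sum_eq_single a]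
    · simp
    · intro b _ hb; simp [hb]
    · simp
    · intro y _ hy; simp [hy]
    · simp
  obtain ⟨c₀, hc₀, n, hlow⟩ := exists_lower_bound_stationary_explorePol hp0 hpi hergC
  obtain ⟨M, hM0, hM⟩ := exists_bound_critic hp0 hp1 hr hγ hα
    (w := fun t => pista (explorePol (etaT t) (θb t)))
    (fun t ht ξ => (hpi _ (θb t) (etaT_pos t).le (etaT_lt_one ht)).1 ξ) hgp hQode
  have hθb : ∀ t, 0 ≤ t → ∀ x a, |zetaT t * sigsta (softmaxPol (θb t)) (x, a) *
      (Qb t x a - ∑ a', Qb t x a' * softmaxPol (θb t) x a')| ≤ 2 * M * zetaT t := by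
    intro t ht x a
    have h1 : |advantage (softmaxPol (θb t)) (Qb t) x a| ≤ 2 * M :=
      abs_advantage_le (hfp t) (hM t ht) x a
    have h2 := (hsig (θb t)).1 (x, a)
    have h3 := (hsig (θb t)).le_one (x, a)
    have h4 := zetaT_pos ht
    rw [abs_mul, abs_of_nonneg (mul_nonneg h4.le h2), mul_comm (2 * M)]
    exact mul_le_mul (mul_le_of_le_one_right h4.le h3) h1 (abs_nonneg _) h4.le
  have hfLip : ∀ s t, 0 ≤ s → s ≤ t → ∀ x a,
      |softmaxPol (θb t) x a - softmaxPol (θb s) x a|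
        ≤ 4 * M * (Real.log (t + 1) - Real.log (s + 1)) := by
    intro s t hs hst x a
    refine abs_sub_le_log (fun t ht => hasDerivAt_softmaxPol (hθode t ht) x a) (fun t ht => ?_)
      hs hst
    rw [abs_mul, abs_of_nonneg ((hfp t).1 x a)]
    have h1 := abs_sum_mul_le_of_sum_eq_one ((hfp t).1 x) ((hfp t).2 x) (hθb t ht.le x)
    refine (mul_le_of_le_one_left (abs_nonneg _) ((hfp t).le_one x a)).trans ?_
    refine (abs_sub _ _).trans ?_
    linarith [hθb t ht.le x a]
  have hηLip : ∀ s t, 0 ≤ s → s ≤ t →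
      |etaT t - etaT s| ≤ 1 * (Real.log (t + 1) - Real.log (s + 1)) := by
    intro s t hs hst
    have hd : ∀ t, 0 ≤ t → HasDerivAt etaT (deriv etaT t) t := fun t ht => by
      obtain ⟨η', h, -⟩ := hasDerivAt_etaT ht
      exact h.differentiableAt.hasDerivAt
    refine abs_sub_le_log hd (fun t ht => ?_) hs hst
    obtain ⟨η', h, hb⟩ := hasDerivAt_etaT ht.le
    rw [h.deriv, one_mul]
    exact hb.trans (mul_le_of_le_one_right (zetaT_pos ht.le).le (etaT_le_one t))
  have hRLip : ∀ s t, 0 ≤ s → s ≤ t → ∀ x a,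
      |Vq (explorePol (etaT t) (θb t)) x a - Vq (explorePol (etaT s) (θb s)) x a|
        ≤ c * (Fintype.card A * (1 + 4 * M) * c) * (Real.log (t + 1) - Real.log (s + 1)) := by
    intro s t hs hst x a
    refine ((hval _ (hgp t (hs.trans hst))).abs_sub_le (hval _ (hgp s hs)) hp0 hp1 hr hγ.1.le hγ.2
      (hgp t (hs.trans hst)) (hgp s hs)
      (D := (1 + 4 * M) * (Real.log (t + 1) - Real.log (s + 1))) (fun x a => ?_) x a).trans_eq ?_
    · refine (abs_explorePol_sub_explorePol_le (etaT_pos s).le (etaT_le_one s) _ _ x a).trans ?_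
      linarith [hηLip s t hs hst, hfLip s t hs hst x a]
    · ring
  obtain ⟨C, T, hC0, hT0, htrack⟩ := exists_critic_tracking hp0 hp1 hγ hα hc₀
    (w := fun t => pista (explorePol (etaT t) (θb t)))
    (fun t ht ξ => hlow _ (θb t) (etaT_pos t).le (etaT_lt_one ht) ξ) hgp hQode
    (R := fun t => Vq (explorePol (etaT t) (θb t))) (fun t ht => hval _ (hgp t ht)) hRLip
  set C₁ : ℝ := C + c * (Fintype.card A * c) with hC₁
  have hC₁0 : 0 ≤ C₁ := by positivity
  have herr : ∀ t, T ≤ t → ∀ x a,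
      |Qb t x a - Vq (softmaxPol (θb t)) x a| ≤ C₁ * etaT t := by
    intro t ht x a
    have h1 := htrack t ht x a
    have h2 := (hval _ (hgp t (hT0.trans ht))).abs_sub_le (hval _ (hfp t)) hp0 hp1 hr hγ.1.le hγ.2
      (hgp t (hT0.trans ht)) (hfp t)
      (fun x a => abs_explorePol_sub_softmaxPol_le (etaT_pos t).le (θb t) x a) x a
    refine (abs_sub_le _ (Vq (explorePol (etaT t) (θb t)) x a) _).trans
      ((add_le_add h1 h2).trans_eq ?_)
    rw [hC₁]; ring
  have hGb : ∀ ϑ x a, |grad ϑ x a| ≤ c * (2 * c) := by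
    intro ϑ x a
    have hp := isPolicy_softmaxPol ϑ
    have h1 := abs_advantage_le hp (hqb _ hp) x a
    rw [hgradeq, abs_mul, abs_of_pos hc0, abs_mul, abs_of_nonneg ((hsig ϑ).1 _)]
    exact mul_le_mul_of_nonneg_left
      ((mul_le_of_le_one_left (abs_nonneg _) ((hsig ϑ).le_one _)).trans h1) hc0.le
  set e : ℝ := c * (2 * c) * (2 * C₁) with he
  set E : ℝ := Fintype.card X * (Fintype.card A * e) with hE
  have hE0 : 0 ≤ E := by positivity
  set H : ℝ → ℝ := fun t =>
    J (softmaxPol (θb t)) + E * Real.arctan (Real.log (t + 1)) with hH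
  set H' : ℝ → ℝ := fun t => c * (∑ x, ∑ a, sigsta (softmaxPol (θb t)) (x, a)
    * advantage (softmaxPol (θb t)) (Vq (softmaxPol (θb t))) x a
    * (zetaT t * sigsta (softmaxPol (θb t)) (x, a) *
        (Qb t x a - ∑ a', Qb t x a' * softmaxPol (θb t) x a'))) + E * (zetaT t * etaT t) with hH'
  have hHd : ∀ t, T ≤ t → HasDerivAt H (H' t) t := fun t ht =>
    (hasDerivAt_return_softmaxPol hγ.2 hsig hsigLip hval hJ (hθode t (hT0.trans ht))).add
      ((hasDerivAt_arctan_log (hT0.trans ht)).const_mul E)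
  have hHsum : ∀ t, T ≤ t →
      ∑ x, ∑ a, (1 - γ) * zetaT t * grad (θb t) x a ^ 2 ≤ H' t := by
    intro t ht
    have hEsum : E * (zetaT t * etaT t) = ∑ _x : X, ∑ _a : A, e * (zetaT t * etaT t) := by
      simp only [Finset.sum_const, Finset.card_univ, nsmul_eq_mul]
      rw [hE]; ring
    simp only [hH']
    rw [hEsum, Finset.mul_sum, ← Finset.sum_add_distrib]
    refine Finset.sum_le_sum fun x _ => ?_
    rw [Finset.mul_sum, ← Finset.sum_add_distrib]
    refine Finset.sum_le_sum fun a _ => ?_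
    set f := softmaxPol (θb t)
    set σ := sigsta f (x, a) with hσ
    set G := grad (θb t) x a with hG
    have hσA : σ * advantage f (Vq f) x a = (1 - γ) * G := by
      rw [hG, hgradeq, ← mul_assoc, hcγ, one_mul]
    set δ := advantage f (Qb t) x a - advantage f (Vq f) x a with hδ
    have hδb : |δ| ≤ 2 * (C₁ * etaT t) := by
      rw [hδ, advantage_sub]
      exact abs_advantage_le (hfp t) (herr t ht) x a
    have hsplit : c * (σ * advantage f (Vq f) x a
        * (zetaT t * σ * (Qb t x a - ∑ a', Qb t x a' * f x a')))
        = zetaT t * ((1 - γ) * G ^ 2 + G * σ * δ) := by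
      have h1 : Qb t x a - ∑ a', Qb t x a' * f x a' = advantage f (Vq f) x a + δ := by
        rw [hδ]; simp only [advantage]; ring
      calc _ = (c * (σ * advantage f (Vq f) x a)) * zetaT t
            * (σ * advantage f (Vq f) x a + σ * δ) := by rw [h1]; ring
        _ = ((1 - γ) * c) * G * zetaT t * ((1 - γ) * G + σ * δ) := by rw [hσA]; ring
        _ = _ := by rw [hcγ]; ring
    have hbound : |G * σ * δ| ≤ e * etaT t := by
      have h1 : |G * σ| ≤ c * (2 * c) := by
        rw [abs_mul, abs_of_nonneg ((hsig (θb t)).1 (x, a))]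
        exact (mul_le_of_le_one_right (abs_nonneg _) ((hsig (θb t)).le_one _)).trans (hGb _ x a)
      rw [abs_mul]
      calc |G * σ| * |δ| ≤ c * (2 * c) * (2 * (C₁ * etaT t)) :=
            mul_le_mul h1 hδb (abs_nonneg _) (by positivity)
        _ = e * etaT t := by rw [he]; ring
    have hζ := zetaT_pos (hT0.trans ht)
    rw [hsplit]
    have := mul_le_mul_of_nonneg_left (neg_le_of_abs_le hbound) hζ.le
    linarith
  have hterm : ∀ t, T ≤ t → ∀ x a, (1 - γ) * zetaT t * grad (θb t) x a ^ 2 ≤ H' t := by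
    intro t ht x a
    have hζ := zetaT_pos (hT0.trans ht)
    have hnn : ∀ x a, 0 ≤ (1 - γ) * zetaT t * grad (θb t) x a ^ 2 := fun x a => by positivity
    exact (Finset.single_le_sum (fun b _ => hnn x b) (Finset.mem_univ a)).trans
      ((Finset.single_le_sum (f := fun x => ∑ a, (1 - γ) * zetaT t * grad (θb t) x a ^ 2)
        (fun y _ => Finset.sum_nonneg fun b _ => hnn y b) (Finset.mem_univ x)).trans (hHsum t ht))
  have hHmono : MonotoneOn H (Ici T) := by
    refine monotoneOn_of_hasDerivWithinAt_nonneg (convex_Ici T)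
      (fun t ht => (hHd t ht).continuousAt.continuousWithinAt) (f' := H')
      (fun t ht => (hHd t (interior_subset ht)).hasDerivWithinAt) (fun t ht => ?_)
    have ht' : T ≤ t := interior_subset ht
    refine le_trans ?_ (hHsum t ht')
    have hζ := zetaT_pos (hT0.trans ht')
    exact Finset.sum_nonneg fun x _ => Finset.sum_nonneg fun a _ => by positivity
  have hJb : ∀ t, J (softmaxPol (θb t)) ≤ c := fun t => by
    rw [hJ _ (hfp t)]
    exact (le_abs_self _).trans (abs_sum_mul_le_of_sum_eq_one hμ0 hμ1 fun x =>
      abs_sum_mul_le_of_sum_eq_one ((hfp t).1 x) ((hfp t).2 x) (hqb _ (hfp t) x))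
  obtain ⟨l, hl⟩ := exists_tendsto_of_monotoneOn_Ici hHmono (b := c + E * (Real.pi / 2))
    (fun t _ => add_le_add (hJb t)
      (mul_le_mul_of_nonneg_left (Real.arctan_lt_pi_div_two _).le hE0))
  refine ⟨⟨l - E * (Real.pi / 2), ?_⟩, fun x a => ?_⟩
  · have harc : Tendsto (fun t : ℝ => Real.arctan (Real.log (t + 1))) atTop
        (nhds (Real.pi / 2)) :=
      (Real.tendsto_arctan_atTop.mono_right nhdsWithin_le_nhds).comp tendsto_log_add_one
    refine (hl.sub (harc.const_mul E)).congr fun t => ?_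
    simp only [hH]; ring
  · obtain ⟨L, hL⟩ := hsigLip
    refine tendsto_zero_of_log_lipschitz (l := l) (κ := 1 - γ) (K := c * (|L| *
      (Fintype.card X * (Fintype.card A * (4 * M))) * (2 * c) + (Fintype.card A * (4 * M) * c
        + 2 * (c * (Fintype.card A * (4 * M) * c))))) hT0 hγ1 hHd
      (fun t ht => hterm t ht x a) hl (fun s t hs hst => ?_)
    have hs0 : 0 ≤ s := hT0.trans hs
    set Δ := Real.log (t + 1) - Real.log (s + 1) with hΔ
    have hΔ0 : 0 ≤ Δ := sub_nonneg.2 (log_add_one_mono hs0 hst)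
    have hD := hfLip s t hs0 hst
    set f := softmaxPol (θb t) with hf
    set f' := softmaxPol (θb s) with hf'
    have h1 : |sigsta f (x, a) - sigsta f' (x, a)|
        ≤ |L| * (Fintype.card X * (Fintype.card A * (4 * M))) * Δ := by
      have h := (Finset.single_le_sum (f := fun ξ => |sigsta f ξ - sigsta f' ξ|)
        (fun _ _ => abs_nonneg _) (Finset.mem_univ (x, a))).trans (hL f f')
      refine h.trans ?_
      have hsum : ∑ x, ∑ a, |f x a - f' x a|
          ≤ Fintype.card X * (Fintype.card A * (4 * M * Δ)) := by
        calc ∑ x, ∑ a, |f x a - f' x a| ≤ ∑ _x : X, ∑ _a : A, 4 * M * Δ :=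
              Finset.sum_le_sum fun x _ => Finset.sum_le_sum fun a _ => hD x a
          _ = _ := by simp
      calc L * ∑ x, ∑ a, |f x a - f' x a| ≤ |L| * ∑ x, ∑ a, |f x a - f' x a| := by
            gcongr; exact le_abs_self L
        _ ≤ |L| * (Fintype.card X * (Fintype.card A * (4 * M * Δ))) := by gcongr
        _ = _ := by ring
    have h2 := abs_advantage_le (hfp t) (hqb _ (hfp t)) x a
    have h3 := abs_advantage_sub_le hc0.le (hqb _ (hfp t)) hD x a
    have h4 : |advantage f' (Vq f) x a - advantage f' (Vq f') x a|
        ≤ 2 * (c * (Fintype.card A * (4 * M * Δ) * c)) := by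
      rw [advantage_sub]
      exact abs_advantage_le (hfp s) ((hval _ (hfp t)).abs_sub_le (hval _ (hfp s)) hp0 hp1 hr
        hγ.1.le hγ.2 (hfp t) (hfp s) hD) x a
    rw [hgradeq, hgradeq, ← mul_sub, abs_mul, abs_of_pos hc0, mul_assoc c]
    gcongr
    have hsplit : sigsta f (x, a) * advantage f (Vq f) x a
        - sigsta f' (x, a) * advantage f' (Vq f') x a
        = (sigsta f (x, a) - sigsta f' (x, a)) * advantage f (Vq f) x a
          + sigsta f' (x, a) * ((advantage f (Vq f) x a - advantage f' (Vq f) x a)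
            + (advantage f' (Vq f) x a - advantage f' (Vq f') x a)) := by ring
    rw [hsplit, add_mul]
    refine (abs_add_le _ _).trans (add_le_add ?_ ?_)
    · rw [abs_mul]
      calc _ ≤ |L| * (Fintype.card X * (Fintype.card A * (4 * M))) * Δ * (2 * c) :=
            mul_le_mul h1 h2 (abs_nonneg _) (by positivity)
        _ = _ := by ring
    · rw [abs_mul, abs_of_nonneg ((hsig (θb s)).1 (x, a))]
      refine (mul_le_of_le_one_left (abs_nonneg _) ((hsig (θb s)).le_one _)).trans ?_
      refine (abs_add_le _ _).trans ((add_le_add h3 h4).trans_eq ?_)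
      ring
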